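/- There is an absolute constant C > 0 with the following property. Let G be a finite edge-weighted graph with positive edge weights and let ε ∈ (0, 1). Let W be a walk in G and let P be a shortest path in G, and suppose R := min_{v ∈ V(W)} d_G(v, P) is finite. Then there exists a subset F ⊆ E(G) containing all edges of W such that w(F) ≤ C · (ε⁻³ · w(W) + ε⁻² · R), and such that for every vertex p of W and every vertex q of P, d_{F ∪ E(P)}(p, q) ≤ (1 + 4ε) · d_G(p, q). -/

import Mathlib

open scoped ENNReal BigOperators

universe u

/-- A finite edge-weighted graph on vertex type `V`: an edge set of unordered pairs of
distinct vertices together with a positive weight on each edge. -/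
structure WGraph (V : Type u) where
  edges : Finset (Sym2 V)
  loopless : ∀ e ∈ edges, ¬ e.IsDiag
  w : Sym2 V → ℝ
  w_pos : ∀ e ∈ edges, 0 < w e

/-- The length of the walk starting at `p` and visiting the points of the list in order,
with respect to the edge weight `w`. -/
noncomputable def walkLen {V : Type u} (w : Sym2 V → ℝ) : V → List V → ℝ
  | _, [] => 0
  | p, x :: xs => w s(p, x) + walkLen w x xs

/-- `p :: l` is a walk from `p` to `q` all of whose steps are edges of `F`. -/
def IsWalkIn {V : Type u} (F : Finset (Sym2 V)) (p q : V) (l : List V) : Prop :=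
  List.Chain (fun a b => s(a, b) ∈ F) p l ∧ (p :: l).getLast (List.cons_ne_nil p l) = q

/-- The distance from `p` to `q` using only edges of `F`: the infimum in `[0, ∞]` of
lengths of walks in `F` from `p` to `q`. -/
noncomputable def distIn {V : Type u} (G : WGraph V) (F : Finset (Sym2 V)) (p q : V) :
    ℝ≥0∞ :=
  ⨅ (l : List V) (_ : IsWalkIn F p q l), ENNReal.ofReal (walkLen G.w p l)

/-- The graph distance `d_G`. -/
noncomputable def gdist {V : Type u} (G : WGraph V) (p q : V) : ℝ≥0∞ :=
  distIn G G.edges p q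

/-- `p :: l` is a shortest path in `G` from `p` to `q`: a walk with no repeated vertex
whose length equals the graph distance between its endpoints. -/
def IsShortestPath {V : Type u} (G : WGraph V) (p q : V) (l : List V) : Prop :=
  IsWalkIn G.edges p q l ∧ (p :: l).Nodup ∧
    ENNReal.ofReal (walkLen G.w p l) = gdist G p q

/-- The total weight of a set of edges. -/
noncomputable def setWeight {V : Type u} (G : WGraph V) (F : Finset (Sym2 V)) : ℝ :=
  ∑ e ∈ F, G.w e

/-- The set of edges of the walk `p :: l`. -/
def edgesOfWalk {V : Type u} [DecidableEq V] : V → List V → Finset (Sym2 V)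
  | _, [] => ∅
  | p, x :: xs => insert s(p, x) (edgesOfWalk x xs)

section Spanner

variable {V : Type u}

theorem isWalkIn_nil {F : Finset (Sym2 V)} {p q : V} : IsWalkIn F p q [] ↔ p = q := by
  simp [IsWalkIn, List.Chain]

theorem isWalkIn_cons {F : Finset (Sym2 V)} {p q x : V} {l : List V} :
    IsWalkIn F p q (x :: l) ↔ s(p, x) ∈ F ∧ IsWalkIn F x q l := by
  simp [IsWalkIn, List.Chain, and_assoc]

theorem IsWalkIn.mono {F F' : Finset (Sym2 V)} (h : F ⊆ F') :
    ∀ {l : List V} {p q : V}, IsWalkIn F p q l → IsWalkIn F' p q l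
  | [], _, _, hw => isWalkIn_nil.2 (isWalkIn_nil.1 hw)
  | _ :: _, _, _, hw =>
    isWalkIn_cons.2 ⟨h (isWalkIn_cons.1 hw).1, IsWalkIn.mono h (isWalkIn_cons.1 hw).2⟩

theorem walkLen_nonneg (G : WGraph V) {F : Finset (Sym2 V)} (hF : F ⊆ G.edges) :
    ∀ {l : List V} {p q : V}, IsWalkIn F p q l → 0 ≤ walkLen G.w p l
  | [], _, _, _ => le_rfl
  | _ :: _, _, _, hw =>
    add_nonneg (G.w_pos _ (hF (isWalkIn_cons.1 hw).1)).le
      (walkLen_nonneg G hF (isWalkIn_cons.1 hw).2)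

theorem distIn_le (G : WGraph V) {F : Finset (Sym2 V)} {l : List V} {p q : V}
    (hw : IsWalkIn F p q l) : distIn G F p q ≤ ENNReal.ofReal (walkLen G.w p l) :=
  iInf₂_le l hw

theorem distIn_self (G : WGraph V) (F : Finset (Sym2 V)) (p : V) : distIn G F p p = 0 := by
  have := distIn_le G (F := F) (l := []) (p := p) (q := p) (isWalkIn_nil.2 rfl)
  simpa [walkLen] using this

theorem distIn_mono (G : WGraph V) {F F' : Finset (Sym2 V)} (h : F ⊆ F') (p q : V) :
    distIn G F' p q ≤ distIn G F p q :=
  le_iInf₂ fun _ hl => distIn_le G (hl.mono h)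

theorem distIn_edge_add (G : WGraph V) {F : Finset (Sym2 V)} {p x : V}
    (he : s(p, x) ∈ F) (q : V) :
    distIn G F p q ≤ ENNReal.ofReal (G.w s(p, x)) + distIn G F x q := by
  conv_rhs => unfold distIn
  simp only [ENNReal.add_iInf]
  refine le_iInf₂ fun l hl => ?_
  exact (distIn_le G (isWalkIn_cons.2 ⟨he, hl⟩)).trans (ENNReal.ofReal_add_le)

theorem distIn_edge (G : WGraph V) {F : Finset (Sym2 V)} {p x : V} (he : s(p, x) ∈ F) :
    distIn G F p x ≤ ENNReal.ofReal (G.w s(p, x)) := by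
  simpa [distIn_self] using distIn_edge_add G he x

theorem distIn_walk_add (G : WGraph V) {F : Finset (Sym2 V)} (hF : F ⊆ G.edges) (r : V) :
    ∀ {l : List V} {p q : V}, IsWalkIn F p q l →
      distIn G F p r ≤ ENNReal.ofReal (walkLen G.w p l) + distIn G F q r
  | [], p, q, hw => by
    rw [isWalkIn_nil] at hw; subst hw; simp [walkLen]
  | x :: l, p, q, hw => by
    rw [isWalkIn_cons] at hw
    rw [walkLen, ENNReal.ofReal_add (G.w_pos _ (hF hw.1)).le (walkLen_nonneg G hF hw.2), add_assoc]
    exact (distIn_edge_add G hw.1 r).trans (by gcongr; exact distIn_walk_add G hF r hw.2)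

theorem distIn_triangle (G : WGraph V) {F : Finset (Sym2 V)} (hF : F ⊆ G.edges) (p q r : V) :
    distIn G F p r ≤ distIn G F p q + distIn G F q r := by
  conv_rhs => enter [1]; unfold distIn
  simp only [ENNReal.iInf_add]
  exact le_iInf₂ fun l hl => distIn_walk_add G hF r hl

theorem distIn_walk_rev (G : WGraph V) {F : Finset (Sym2 V)} (hF : F ⊆ G.edges) :
    ∀ {l : List V} {p q : V}, IsWalkIn F p q l →
      distIn G F q p ≤ ENNReal.ofReal (walkLen G.w p l)
  | [], p, q, hw => by
    rw [isWalkIn_nil] at hw; subst hw; simp [distIn_self]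
  | x :: l, p, q, hw => by
    rw [isWalkIn_cons] at hw
    rw [walkLen, ENNReal.ofReal_add (G.w_pos _ (hF hw.1)).le (walkLen_nonneg G hF hw.2), add_comm]
    refine (distIn_triangle G hF q x p).trans (add_le_add (distIn_walk_rev G hF hw.2) ?_)
    rw [Sym2.eq_swap]
    exact distIn_edge G (by rw [Sym2.eq_swap]; exact hw.1)

theorem distIn_symm (G : WGraph V) {F : Finset (Sym2 V)} (hF : F ⊆ G.edges) (p q : V) :
    distIn G F p q = distIn G F q p :=
  le_antisymm (le_iInf₂ fun _ hl => distIn_walk_rev G hF hl)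
    (le_iInf₂ fun _ hl => distIn_walk_rev G hF hl)

theorem exists_weight_lower (G : WGraph V) : ∃ c : ℝ, 0 < c ∧ ∀ e ∈ G.edges, c ≤ G.w e := by
  rcases G.edges.eq_empty_or_nonempty with h | h
  · exact ⟨1, one_pos, by simp [h]⟩
  · obtain ⟨e, he, hm⟩ := G.edges.exists_min_image G.w h
    exact ⟨G.w e, G.w_pos e he, hm⟩

theorem length_le_walkLen (G : WGraph V) {c : ℝ} (hc : ∀ e ∈ G.edges, c ≤ G.w e) :
    ∀ {l : List V} {p q : V}, IsWalkIn G.edges p q l → c * l.length ≤ walkLen G.w p l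
  | [], _, _, _ => by simp [walkLen]
  | x :: l, p, q, hw => by
    rw [isWalkIn_cons] at hw
    have := length_le_walkLen G hc hw.2
    have := hc _ hw.1
    simp only [walkLen, List.length_cons]; push_cast; linarith

/-- Shortest walks exist. -/
theorem exists_shortest [Finite V] (G : WGraph V) {p q : V} (h : gdist G p q ≠ ⊤) :
    ∃ l, IsWalkIn G.edges p q l ∧ walkLen G.w p l = (gdist G p q).toReal := by
  obtain ⟨l₀, h₀⟩ : ∃ l, IsWalkIn G.edges p q l := by
    by_contra hn
    push Not at hn
    exact h (by simp [gdist, distIn, hn])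
  obtain ⟨c, hc, hcw⟩ := exists_weight_lower G
  obtain ⟨N, hN⟩ := exists_nat_gt (walkLen G.w p l₀ / c)
  rw [div_lt_iff₀ hc] at hN
  have hfin : {l : List V | IsWalkIn G.edges p q l ∧ l.length ≤ N}.Finite :=
    (List.finite_length_le V N).subset fun l hl => hl.2
  have hl₀ : l₀.length ≤ N := by
    have := length_le_walkLen G hcw h₀
    have h3 : c * l₀.length < c * N := by linarith
    exact_mod_cast (lt_of_mul_lt_mul_left h3 hc.le).le
  obtain ⟨l, hl, hmin⟩ := hfin.exists_minimalFor (fun l => walkLen G.w p l) _ ⟨l₀, h₀, hl₀⟩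
  have hmin' : ∀ l' ∈ {l : List V | IsWalkIn G.edges p q l ∧ l.length ≤ N},
      walkLen G.w p l ≤ walkLen G.w p l' := fun l' h' => by
    rcases le_total (walkLen G.w p l) (walkLen G.w p l') with h | h
    · exact h
    · exact hmin h' h
  refine ⟨l, hl.1, ?_⟩
  have : gdist G p q = ENNReal.ofReal (walkLen G.w p l) := by
    refine le_antisymm (distIn_le G hl.1) (le_iInf₂ fun l' h' => ENNReal.ofReal_le_ofReal ?_)
    by_cases hle : l'.length ≤ N
    · exact hmin' l' ⟨h', hle⟩
    · have h1 := hmin' l₀ ⟨h₀, hl₀⟩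
      have h2 := length_le_walkLen G hcw h'
      have h3 : (N : ℝ) ≤ l'.length := by exact_mod_cast (not_le.1 hle).le
      nlinarith
  rw [this, ENNReal.toReal_ofReal (walkLen_nonneg G subset_rfl hl.1)]

variable [DecidableEq V]

theorem edgesOfWalk_subset {F : Finset (Sym2 V)} :
    ∀ {l : List V} {p q : V}, IsWalkIn F p q l → edgesOfWalk p l ⊆ F
  | [], _, _, _ => by simp [edgesOfWalk]
  | x :: l, p, q, hw => by
    rw [isWalkIn_cons] at hw
    exact Finset.insert_subset hw.1 (edgesOfWalk_subset hw.2)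

theorem isWalkIn_edgesOfWalk {F : Finset (Sym2 V)} :
    ∀ {l : List V} {p q : V}, IsWalkIn F p q l → IsWalkIn (edgesOfWalk p l) p q l
  | [], _, _, h => isWalkIn_nil.2 (isWalkIn_nil.1 h)
  | x :: l, p, q, hw => by
    rw [isWalkIn_cons] at hw ⊢
    exact ⟨Finset.mem_insert_self _ _,
      (isWalkIn_edgesOfWalk hw.2).mono (Finset.subset_insert _ _)⟩

theorem setWeight_nonneg (G : WGraph V) {A : Finset (Sym2 V)} (hA : A ⊆ G.edges) :
    0 ≤ setWeight G A := Finset.sum_nonneg fun e he => (G.w_pos e (hA he)).le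

theorem setWeight_union_le (G : WGraph V) {A B : Finset (Sym2 V)} (hA : A ⊆ G.edges) :
    setWeight G (A ∪ B) ≤ setWeight G A + setWeight G B := by
  have h := Finset.sum_union_inter (s₁ := A) (s₂ := B) (f := G.w)
  have : 0 ≤ setWeight G (A ∩ B) :=
    setWeight_nonneg G (Finset.inter_subset_left.trans hA)
  simp only [setWeight] at *
  linarith

theorem setWeight_edgesOfWalk (G : WGraph V) :
    ∀ {l : List V} {p q : V}, IsWalkIn G.edges p q l →
      setWeight G (edgesOfWalk p l) ≤ walkLen G.w p l
  | [], _, _, _ => by simp [edgesOfWalk, setWeight, walkLen]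
  | x :: l, p, q, hw => by
    rw [isWalkIn_cons] at hw
    have h := setWeight_union_le G (A := {s(p, x)}) (B := edgesOfWalk x l) (by simpa using hw.1)
    have h2 := setWeight_edgesOfWalk G hw.2
    rw [← Finset.insert_eq] at h
    have h3 : setWeight G {s(p, x)} = G.w s(p, x) := by simp [setWeight]
    simp only [edgesOfWalk, walkLen]
    linarith

theorem path_set [Finite V] (G : WGraph V) {p q : V} (h : gdist G p q ≠ ⊤) :
    ∃ F ⊆ G.edges, setWeight G F ≤ (gdist G p q).toReal ∧
      distIn G F p q ≤ ENNReal.ofReal (gdist G p q).toReal := by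
  obtain ⟨l, hl, he⟩ := exists_shortest G h
  exact ⟨edgesOfWalk p l, edgesOfWalk_subset hl, he ▸ setWeight_edgesOfWalk G hl,
    he ▸ distIn_le G (isWalkIn_edgesOfWalk hl)⟩

/-- Appending a step at the end of a walk. -/
theorem walk_snoc (G : WGraph V) {F : Finset (Sym2 V)} {a : V} :
    ∀ {l : List V} {p q : V}, IsWalkIn F p q l → s(q, a) ∈ F →
      IsWalkIn F p a (l ++ [a]) ∧
      walkLen G.w p (l ++ [a]) = walkLen G.w p l + G.w s(q, a) ∧
      edgesOfWalk p (l ++ [a]) = insert s(q, a) (edgesOfWalk p l)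
  | [], p, q, hw, he => by
    rw [isWalkIn_nil] at hw; subst hw
    simp [isWalkIn_cons, isWalkIn_nil, he, walkLen, edgesOfWalk]
  | x :: l, p, q, hw, he => by
    rw [isWalkIn_cons] at hw
    obtain ⟨h1, h2, h3⟩ := walk_snoc G hw.2 he
    refine ⟨isWalkIn_cons.2 ⟨hw.1, h1⟩, ?_, ?_⟩
    · simp only [List.cons_append, walkLen, h2]; ring
    · simp only [List.cons_append, edgesOfWalk, h3]; exact Finset.insert_comm _ _ _

/-- Splitting a walk at a vertex `v` into a walk back to the start and one to the end. -/
theorem walk_split (G : WGraph V) {F : Finset (Sym2 V)} {v b : V} :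
    ∀ {l : List V} {a : V}, IsWalkIn F a b l → v ∈ a :: l →
      ∃ l₁ l₂, IsWalkIn F v a l₁ ∧ IsWalkIn F v b l₂ ∧
        walkLen G.w v l₁ + walkLen G.w v l₂ = walkLen G.w a l ∧
        edgesOfWalk v l₁ ⊆ edgesOfWalk a l ∧ edgesOfWalk v l₂ ⊆ edgesOfWalk a l ∧
        (∀ x, x ∈ a :: l ↔ x ∈ v :: l₁ ∨ x ∈ v :: l₂)
  | l, a, hw, hv => by
    by_cases hva : v = a
    · subst hva
      refine ⟨[], l, isWalkIn_nil.2 rfl, hw, by simp [walkLen], by simp [edgesOfWalk],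
        subset_rfl, fun x => ?_⟩
      simp
    · match l, hw, hv with
      | [], _, hv => simp at hv; exact absurd hv hva
      | y :: l, hw, hv =>
        rw [isWalkIn_cons] at hw
        have hv' : v ∈ y :: l := (List.mem_cons.1 hv).resolve_left hva
        obtain ⟨l₁, l₂, h1, h2, h3, h4, h5, h6⟩ := walk_split G hw.2 hv'
        have he : s(y, a) ∈ F := by rw [Sym2.eq_swap]; exact hw.1
        obtain ⟨k1, k2, k3⟩ := walk_snoc G h1 he
        refine ⟨l₁ ++ [a], l₂, k1, h2, ?_, ?_, ?_, ?_⟩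
        · rw [k2, walkLen, ← h3, Sym2.eq_swap]; ring
        · rw [k3, edgesOfWalk, Sym2.eq_swap]; exact Finset.insert_subset_insert _ h4
        · exact h5.trans (Finset.subset_insert _ _)
        · intro x
          rw [List.mem_cons, h6 x]
          simp only [List.mem_cons, List.mem_append, List.not_mem_nil, or_false]
          tauto

/-- Scanning along a walk away from its start, adding paths from `s` greedily. -/
theorem scanP [Finite V] (G : WGraph V) {ε : ℝ} (hε : 0 < ε) (s e : V) :
    ∀ (l : List V) (x : V) (c : ℝ), IsWalkIn G.edges x e l →
      (∀ y ∈ x :: l, gdist G s y ≠ ⊤) → (gdist G s x).toReal ≤ c →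
      c ≤ (1 + ε) * (gdist G s x).toReal →
      ∃ F ⊆ G.edges, ε * setWeight G F ≤ c + walkLen G.w x l - (gdist G s e).toReal ∧
        ∀ F', F ⊆ F' → edgesOfWalk x l ⊆ F' → F' ⊆ G.edges →
          distIn G F' s x ≤ ENNReal.ofReal c →
          ∀ q ∈ x :: l, distIn G F' s q ≤ ENNReal.ofReal ((1 + ε) * (gdist G s q).toReal)
  | [], x, c, hw, hfin, h1, h2 => by
    rw [isWalkIn_nil] at hw; subst hw
    refine ⟨∅, by simp, by simp [setWeight, walkLen, h1], ?_⟩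
    intro F' _ _ _ hd q hq
    simp at hq; subst hq
    exact hd.trans (ENNReal.ofReal_le_ofReal h2)
  | y :: l, x, c, hw, hfin, h1, h2 => by
    rw [isWalkIn_cons] at hw
    have hwpos := G.w_pos _ hw.1
    have hc0 : 0 ≤ c := ENNReal.toReal_nonneg.trans h1
    have hfy : gdist G s y ≠ ⊤ := hfin y (by simp)
    have hfx : gdist G s x ≠ ⊤ := hfin x (by simp)
    have htri : (gdist G s y).toReal ≤ c + G.w s(x, y) := by
      have h := (distIn_triangle G subset_rfl s x y).trans
        (add_le_add le_rfl (distIn_edge G hw.1))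
      have h' := ENNReal.toReal_mono (ENNReal.add_ne_top.2 ⟨hfx, ENNReal.ofReal_ne_top⟩) h
      rw [ENNReal.toReal_add hfx ENNReal.ofReal_ne_top, ENNReal.toReal_ofReal hwpos.le] at h'
      simp only [gdist] at *
      linarith
    have hfin' : ∀ z ∈ y :: l, gdist G s z ≠ ⊤ := fun z hz => hfin z (List.mem_cons_of_mem _ hz)
    by_cases hcase : c + G.w s(x, y) ≤ (1 + ε) * (gdist G s y).toReal
    · obtain ⟨F, hF, hwt, hgood⟩ := scanP G hε s e l y _ hw.2 hfin' htri hcase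
      refine ⟨F, hF, by simp only [walkLen]; linarith, ?_⟩
      intro F' hFF hE hF' hd q hq
      rw [edgesOfWalk, Finset.insert_subset_iff] at hE
      rcases List.mem_cons.1 hq with rfl | hq
      · exact hd.trans (ENNReal.ofReal_le_ofReal h2)
      · refine hgood F' hFF hE.2 hF' ?_ q hq
        rw [ENNReal.ofReal_add hc0 hwpos.le]
        exact (distIn_triangle G hF' s x y).trans (add_le_add hd (distIn_edge G hE.1))
    · push Not at hcase
      have hD : 0 ≤ (gdist G s y).toReal := ENNReal.toReal_nonneg
      obtain ⟨F, hF, hwt, hgood⟩ := scanP G hε s e l y (gdist G s y).toReal hw.2 hfin' le_rfl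
        (by nlinarith)
      obtain ⟨A, hA, hAw, hAd⟩ := path_set G hfy
      refine ⟨A ∪ F, Finset.union_subset hA hF, ?_, ?_⟩
      · have := setWeight_union_le G (B := F) hA
        simp only [walkLen]
        nlinarith
      intro F' hFF hE hF' hd q hq
      rw [edgesOfWalk, Finset.insert_subset_iff] at hE
      rcases List.mem_cons.1 hq with rfl | hq
      · exact hd.trans (ENNReal.ofReal_le_ofReal h2)
      · exact hgood F' (Finset.subset_union_right.trans hFF) hE.2 hF'
          ((distIn_mono G (Finset.subset_union_left.trans hFF) _ _).trans hAd) q hq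

theorem fin_trans (G : WGraph V) {p q r : V} (h : gdist G p q ≠ ⊤) (h' : gdist G q r ≠ ⊤) :
    gdist G p r ≠ ⊤ :=
  ne_top_of_le_ne_top (ENNReal.add_ne_top.2 ⟨h, h'⟩) (distIn_triangle G subset_rfl p q r)

theorem fin_of_walk (G : WGraph V) {l : List V} {p q : V} (h : IsWalkIn G.edges p q l) :
    gdist G p q ≠ ⊤ := ne_top_of_le_ne_top ENNReal.ofReal_ne_top (distIn_le G h)

theorem real_triangle (G : WGraph V) {p q r : V} (h : gdist G p q ≠ ⊤) (h' : gdist G q r ≠ ⊤) :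
    (gdist G p r).toReal ≤ (gdist G p q).toReal + (gdist G q r).toReal := by
  rw [← ENNReal.toReal_add h h']
  exact ENNReal.toReal_mono (ENNReal.add_ne_top.2 ⟨h, h'⟩) (distIn_triangle G subset_rfl p q r)

theorem real_le_walk (G : WGraph V) {l : List V} {p q : V} (h : IsWalkIn G.edges p q l) :
    (gdist G p q).toReal ≤ walkLen G.w p l := by
  have := ENNReal.toReal_mono ENNReal.ofReal_ne_top (distIn_le G h)
  rwa [ENNReal.toReal_ofReal (walkLen_nonneg G subset_rfl h)] at this

theorem gdist_symm (G : WGraph V) (p q : V) : gdist G p q = gdist G q p :=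
  distIn_symm G subset_rfl p q

/-- All vertices on a walk are at finite distance from each other. -/
theorem fin_on_walk (G : WGraph V) {l : List V} {a b : V} (h : IsWalkIn G.edges a b l)
    {x y : V} (hx : x ∈ a :: l) (hy : y ∈ a :: l) : gdist G x y ≠ ⊤ := by
  obtain ⟨_, _, h1, -⟩ := walk_split G h hx
  obtain ⟨_, _, h2, -⟩ := walk_split G h hy
  exact fin_trans G (fin_of_walk G h1) (gdist_symm G y a ▸ fin_of_walk G h2)

/-- Single-source spanner. -/
theorem single_source [Finite V] (G : WGraph V) {ε : ℝ} (hε : 0 < ε) (hε1 : ε < 1)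
    {p₁ p₂ : V} {lP : List V} (hP : IsShortestPath G p₁ p₂ lP) (s u : V) (hu : u ∈ p₁ :: lP)
    (hfin : gdist G s u ≠ ⊤) :
    ∃ F ⊆ G.edges, ε * setWeight G F ≤ 5 * (gdist G s u).toReal ∧
      ∀ F', F ⊆ F' → edgesOfWalk p₁ lP ⊆ F' → F' ⊆ G.edges → ∀ q ∈ p₁ :: lP,
        distIn G F' s q ≤ ENNReal.ofReal ((1 + ε) * (gdist G s q).toReal) := by
  obtain ⟨hw, -, hlen⟩ := hP
  have hfinP : ∀ y ∈ p₁ :: lP, gdist G s y ≠ ⊤ := fun y hy =>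
    fin_trans G hfin (fin_on_walk G hw hu hy)
  have hlen' : walkLen G.w p₁ lP = (gdist G p₁ p₂).toReal := by
    rw [← hlen, ENNReal.toReal_ofReal (walkLen_nonneg G subset_rfl hw)]
  obtain ⟨l₁, l₂, h1, h2, h3, h4, h5, h6⟩ := walk_split G hw hu
  have hD : 0 ≤ (gdist G s u).toReal := ENNReal.toReal_nonneg
  obtain ⟨A, hA, hAw, hAd⟩ := path_set G hfin
  obtain ⟨F₁, hF₁, hw₁, hg₁⟩ := scanP G hε s p₁ l₁ u (gdist G s u).toReal h1
    (fun y hy => hfinP y ((h6 y).2 (Or.inl hy))) le_rfl (by nlinarith)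
  obtain ⟨F₂, hF₂, hw₂, hg₂⟩ := scanP G hε s p₂ l₂ u (gdist G s u).toReal h2
    (fun y hy => hfinP y ((h6 y).2 (Or.inr hy))) le_rfl (by nlinarith)
  refine ⟨A ∪ (F₁ ∪ F₂), Finset.union_subset hA (Finset.union_subset hF₁ hF₂), ?_, ?_⟩
  · have u1 := setWeight_union_le G (B := F₁ ∪ F₂) hA
    have u2 := setWeight_union_le G (B := F₂) hF₁
    have f1 := fin_of_walk G h1
    have f2 := fin_of_walk G h2
    have f1' : gdist G p₁ u ≠ ⊤ := gdist_symm G u p₁ ▸ f1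
    have fs : gdist G u s ≠ ⊤ := gdist_symm G s u ▸ hfin
    have sp1 : gdist G s p₁ ≠ ⊤ := fin_trans G hfin f1
    have sp2 : gdist G s p₂ ≠ ⊤ := fin_trans G hfin f2
    have t0 := real_triangle G f1' f2
    have t1 := real_triangle G fs sp1
    have t2 := real_triangle G fs sp2
    have g1 := real_le_walk G h1
    have g2 := real_le_walk G h2
    rw [gdist_symm G p₁ u] at t0
    rw [gdist_symm G u s] at t1 t2
    have k : ε * setWeight G (A ∪ (F₁ ∪ F₂)) ≤
        ε * setWeight G A + ε * setWeight G F₁ + ε * setWeight G F₂ := by nlinarith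
    have k2 : ε * setWeight G A ≤ (gdist G s u).toReal := by
      have := setWeight_nonneg G hA
      nlinarith
    linarith
  · intro F' hFF hE hF' q hq
    have hsu : distIn G F' s u ≤ ENNReal.ofReal (gdist G s u).toReal :=
      (distIn_mono G (Finset.subset_union_left.trans hFF) _ _).trans hAd
    have hFF' := Finset.subset_union_right.trans hFF
    rcases (h6 q).1 hq with hq | hq
    · exact hg₁ F' (Finset.subset_union_left.trans hFF') (h4.trans hE) hF' hsu q hq
    · exact hg₂ F' (Finset.subset_union_right.trans hFF') (h5.trans hE) hF' hsu q hq

/-- Scanning along the walk `W`, selecting sources greedily. `Good F' s` says that `F'` is a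
single-source spanner for `s`. -/
theorem scanW (G : WGraph V) {ε K : ℝ} (hε : 0 < ε) (hK : 0 ≤ K) (m : V → ℝ)
    (hm : ∀ v, 0 ≤ m v) (Good : Finset (Sym2 V) → V → Prop) (e : V) :
    ∀ (l : List V) (s x : V) (δ : ℝ), IsWalkIn G.edges x e l →
      (∀ y ∈ x :: l, ∃ F ⊆ G.edges, setWeight G F ≤ K * m y ∧
        ∀ F', F ⊆ F' → F' ⊆ G.edges → Good F' y) →
      0 ≤ δ → δ ≤ ε * m x →
      ∃ F ⊆ G.edges, ε * setWeight G F ≤ K * (δ + walkLen G.w x l) ∧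
        ∀ F', F ⊆ F' → edgesOfWalk x l ⊆ F' → F' ⊆ G.edges → Good F' s →
          distIn G F' x s ≤ ENNReal.ofReal δ →
          ∀ p ∈ x :: l, ∃ s', Good F' s' ∧ distIn G F' p s' ≤ ENNReal.ofReal (ε * m p)
  | [], s, x, δ, hw, hsingle, h0, h1 => by
    refine ⟨∅, by simp, by simp [setWeight, walkLen]; positivity, ?_⟩
    intro F' _ _ _ hG hd q hq
    simp at hq; subst hq
    exact ⟨s, hG, hd.trans (ENNReal.ofReal_le_ofReal h1)⟩
  | y :: l, s, x, δ, hw, hsingle, h0, h1 => by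
    rw [isWalkIn_cons] at hw
    have hwpos := G.w_pos _ hw.1
    have hsingle' := fun z hz => hsingle z (List.mem_cons_of_mem _ hz)
    by_cases hcase : δ + G.w s(x, y) ≤ ε * m y
    · obtain ⟨F, hF, hwt, hgood⟩ := scanW G hε hK m hm Good e l s y _ hw.2 hsingle'
        (by positivity) hcase
      refine ⟨F, hF, by simp only [walkLen]; rwa [← add_assoc], ?_⟩
      intro F' hFF hE hF' hG hd q hq
      rw [edgesOfWalk, Finset.insert_subset_iff] at hE
      rcases List.mem_cons.1 hq with rfl | hq
      · exact ⟨s, hG, hd.trans (ENNReal.ofReal_le_ofReal h1)⟩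
      · refine hgood F' hFF hE.2 hF' hG ?_ q hq
        rw [add_comm, ENNReal.ofReal_add hwpos.le h0]
        refine (distIn_triangle G hF' y x s).trans (add_le_add ?_ hd)
        rw [distIn_symm G hF']
        exact distIn_edge G hE.1
    · push Not at hcase
      obtain ⟨F, hF, hwt, hgood⟩ := scanW G hε hK m hm Good e l y y 0 hw.2 hsingle' le_rfl
        (mul_nonneg hε.le (hm y))
      obtain ⟨A, hA, hAw, hAd⟩ := hsingle y (by simp)
      refine ⟨A ∪ F, Finset.union_subset hA hF, ?_, ?_⟩
      · have h1 := setWeight_union_le G (B := F) hA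
        have h2 : ε * setWeight G (A ∪ F) ≤ ε * setWeight G A + ε * setWeight G F := by nlinarith
        have h3 : ε * setWeight G A ≤ ε * (K * m y) := by gcongr
        have h4 : K * (ε * m y) ≤ K * (δ + G.w s(x, y)) := by gcongr
        simp only [walkLen]
        linarith
      intro F' hFF hE hF' hG hd q hq
      rw [edgesOfWalk, Finset.insert_subset_iff] at hE
      rcases List.mem_cons.1 hq with rfl | hq
      · exact ⟨s, hG, hd.trans (ENNReal.ofReal_le_ofReal h1)⟩
      · exact hgood F' (Finset.subset_union_right.trans hFF) hE.2 hF'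
          (hAd F' (Finset.subset_union_left.trans hFF) hF') (by simp [distIn_self]) q hq

theorem exists_min_list (f : V → ℝ≥0∞) (a : V) (l : List V) :
    ∃ v ∈ a :: l, f v = ⨅ x ∈ a :: l, f x := by
  obtain ⟨v, hv, hmin⟩ := (a :: l).toFinset.exists_min_image f ⟨a, by simp⟩
  rw [List.mem_toFinset] at hv
  exact ⟨v, hv, le_antisymm (le_iInf₂ fun x hx => hmin x (List.mem_toFinset.2 hx))
    (iInf₂_le v hv)⟩

theorem main_aux [Finite V] (G : WGraph V) (ε : ℝ) (hε : 0 < ε) (hε1 : ε < 1)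
    (a : V) (lW : List V) (hW : List.Chain (fun x y => s(x, y) ∈ G.edges) a lW)
    (p₁ p₂ : V) (lP : List V) (hP : IsShortestPath G p₁ p₂ lP)
    (R : ℝ≥0∞) (hR : R = (⨅ v ∈ a :: lW, ⨅ u ∈ p₁ :: lP, gdist G v u)) (hRt : R ≠ ⊤) :
    ∃ F ⊆ G.edges, edgesOfWalk a lW ⊆ F ∧
      setWeight G F ≤ 16 * (ε⁻¹ ^ 3 * walkLen G.w a lW + ε⁻¹ ^ 2 * R.toReal) ∧
      ∀ p ∈ a :: lW, ∀ q ∈ p₁ :: lP,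
        distIn G (F ∪ edgesOfWalk p₁ lP) p q ≤
          ENNReal.ofReal (1 + 4 * ε) * gdist G p q := by
  obtain ⟨b, hWb⟩ : ∃ b, IsWalkIn G.edges a b lW := ⟨_, hW, rfl⟩
  have hPE : edgesOfWalk p₁ lP ⊆ G.edges := edgesOfWalk_subset hP.1
  have hWE : edgesOfWalk a lW ⊆ G.edges := edgesOfWalk_subset hWb
  have hWlen := walkLen_nonneg G subset_rfl hWb
  -- distance to the path
  set M : V → ℝ≥0∞ := fun v => ⨅ u ∈ p₁ :: lP, gdist G v u with hM
  obtain ⟨v, hv, hvR⟩ := exists_min_list M a lW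
  have hMv : M v = R := by rw [hR, hvR]
  obtain ⟨u₀, hu₀, hu₀R⟩ := exists_min_list (gdist G v) p₁ lP
  have hvu : gdist G v u₀ ≠ ⊤ := by
    rw [hu₀R]; change M v ≠ ⊤; rwa [hMv]
  have hfin : ∀ p ∈ a :: lW, ∀ q ∈ p₁ :: lP, gdist G p q ≠ ⊤ := fun p hp q hq =>
    fin_trans G (fin_trans G (fin_on_walk G hWb hp hv) hvu) (fin_on_walk G hP.1 hu₀ hq)
  set m : V → ℝ := fun v => (M v).toReal with hm
  have hmle : ∀ p ∈ a :: lW, ∀ q ∈ p₁ :: lP, m p ≤ (gdist G p q).toReal := fun p hp q hq =>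
    ENNReal.toReal_mono (hfin p hp q hq) (iInf₂_le q hq)
  let Good : Finset (Sym2 V) → V → Prop := fun F' s => s ∈ a :: lW ∧
    (edgesOfWalk p₁ lP ⊆ F' → ∀ q ∈ p₁ :: lP,
      distIn G F' s q ≤ ENNReal.ofReal ((1 + ε) * (gdist G s q).toReal))
  have hsingle : ∀ y ∈ a :: lW, ∃ F ⊆ G.edges, setWeight G F ≤ (5 / ε) * m y ∧
      ∀ F', F ⊆ F' → F' ⊆ G.edges → Good F' y := by
    intro y hy
    obtain ⟨u, hu, huR⟩ := exists_min_list (gdist G y) p₁ lP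
    obtain ⟨F, hF, hFw, hg⟩ := single_source G hε hε1 hP y u hu (hfin y hy u hu)
    refine ⟨F, hF, ?_, fun F' h1 h2 => ⟨hy, fun h3 => hg F' h1 h3 h2⟩⟩
    rw [huR] at hFw
    rw [div_mul_eq_mul_div, le_div_iff₀ hε, mul_comm]
    exact hFw
  have hK : 0 ≤ 5 / ε := by positivity
  obtain ⟨l₁, l₂, h1, h2, h3, h4, h5, h6⟩ := walk_split G hWb hv
  have hm0 : ∀ v, 0 ≤ m v := fun v => ENNReal.toReal_nonneg
  obtain ⟨F₀, hF₀, hw₀, hg₀⟩ := hsingle v hv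
  obtain ⟨F₁, hF₁, hw₁, hg₁⟩ := scanW G hε hK m hm0 Good a l₁ v v 0 h1
    (fun y hy => hsingle y ((h6 y).2 (Or.inl hy))) le_rfl (mul_nonneg hε.le (hm0 v))
  obtain ⟨F₂, hF₂, hw₂, hg₂⟩ := scanW G hε hK m hm0 Good b l₂ v v 0 h2
    (fun y hy => hsingle y ((h6 y).2 (Or.inr hy))) le_rfl (mul_nonneg hε.le (hm0 v))
  have hF : edgesOfWalk a lW ∪ (F₀ ∪ (F₁ ∪ F₂)) ⊆ G.edges :=
    Finset.union_subset hWE (Finset.union_subset hF₀ (Finset.union_subset hF₁ hF₂))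
  refine ⟨edgesOfWalk a lW ∪ (F₀ ∪ (F₁ ∪ F₂)), hF, Finset.subset_union_left, ?_, ?_⟩
  · have u0 := setWeight_union_le G (B := F₀ ∪ (F₁ ∪ F₂)) hWE
    have u1 := setWeight_union_le G (B := F₁ ∪ F₂) hF₀
    have u2 := setWeight_union_le G (B := F₂) hF₁
    have u3 := setWeight_edgesOfWalk G hWb
    have hmv : m v = R.toReal := by simp only [hm, hMv]
    have hR0 : 0 ≤ R.toReal := ENNReal.toReal_nonneg
    set L := walkLen G.w a lW
    set i := ε⁻¹ with hi
    have hi1 : 1 ≤ i := (one_le_inv₀ hε).2 hε1.le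
    have hie : i * ε = 1 := inv_mul_cancel₀ hε.ne'
    rw [div_eq_mul_inv, ← hi] at hw₀ hw₁ hw₂
    rw [hmv] at hw₀
    have hw12 : setWeight G F₁ + setWeight G F₂ ≤ 5 * i ^ 2 * L := by
      have hs : ε * (setWeight G F₁ + setWeight G F₂) ≤ 5 * i * L := by
        rw [← h3]; linarith
      have := mul_le_mul_of_nonneg_left hs (zero_le_one.trans hi1)
      rw [← mul_assoc, hie, one_mul] at this
      linarith
    have hi2 : i ≤ i ^ 2 := by nlinarith
    have hi3 : i ^ 2 ≤ i ^ 3 := by nlinarith [sq_nonneg i]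
    have a1 : L ≤ i ^ 3 * L := le_mul_of_one_le_left hWlen (by linarith)
    have a2 : i ^ 2 * L ≤ i ^ 3 * L := by gcongr
    have a3 : i * R.toReal ≤ i ^ 2 * R.toReal := by gcongr
    have a4 : 0 ≤ i ^ 2 * R.toReal := by positivity
    linarith
  · intro p hp q hq
    set F' := edgesOfWalk a lW ∪ (F₀ ∪ (F₁ ∪ F₂)) ∪ edgesOfWalk p₁ lP with hF'def
    have hF' : F' ⊆ G.edges := Finset.union_subset hF hPE
    have e0 : edgesOfWalk a lW ⊆ F' := by intro x hx; simp [hF'def, hx]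
    have e1 : F₀ ⊆ F' := by intro x hx; simp [hF'def, hx]
    have e2 : F₁ ⊆ F' := by intro x hx; simp [hF'def, hx]
    have e3 : F₂ ⊆ F' := by intro x hx; simp [hF'def, hx]
    have e4 : edgesOfWalk p₁ lP ⊆ F' := Finset.subset_union_right
    have hgv := hg₀ F' e1 hF'
    obtain ⟨s', hs', hd⟩ : ∃ s', Good F' s' ∧ distIn G F' p s' ≤ ENNReal.ofReal (ε * m p) := by
      rcases (h6 p).1 hp with hp | hp
      · exact hg₁ F' e2 (h4.trans e0) hF' hgv (by simp [distIn_self]) p hp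
      · exact hg₂ F' e3 (h5.trans e0) hF' hgv (by simp [distIn_self]) p hp
    have hsq := hs'.2 e4 q hq
    have hps : gdist G p s' ≠ ⊤ := fin_on_walk G hWb hp hs'.1
    have hsp : gdist G s' p ≠ ⊤ := gdist_symm G p s' ▸ hps
    have hpq := hfin p hp q hq
    have hδ : (gdist G p s').toReal ≤ ε * m p := by
      have := ENNReal.toReal_mono ENNReal.ofReal_ne_top ((distIn_mono G hF' p s').trans hd)
      rwa [ENNReal.toReal_ofReal (mul_nonneg hε.le (hm0 p))] at this
    have ht := real_triangle G hsp hpq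
    rw [gdist_symm G s' p] at ht
    have hmp := hmle p hp q hq
    have hfinal : ε * m p + (1 + ε) * (gdist G s' q).toReal ≤
        (1 + 4 * ε) * (gdist G p q).toReal := by
      set D := (gdist G p q).toReal
      have hD0 : 0 ≤ D := ENNReal.toReal_nonneg
      have b1 : ε * m p ≤ ε * D := by gcongr
      have b2 : (gdist G s' q).toReal ≤ ε * D + D := by linarith
      have b3 : (1 + ε) * (gdist G s' q).toReal ≤ (1 + ε) * (ε * D + D) := by gcongr
      have b4 : ε * (ε * D) ≤ 1 * (ε * D) := by gcongr
      linarith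
    calc distIn G F' p q ≤ distIn G F' p s' + distIn G F' s' q := distIn_triangle G hF' p s' q
      _ ≤ ENNReal.ofReal (ε * m p) + ENNReal.ofReal ((1 + ε) * (gdist G s' q).toReal) :=
        add_le_add hd hsq
      _ = ENNReal.ofReal (ε * m p + (1 + ε) * (gdist G s' q).toReal) :=
        (ENNReal.ofReal_add (mul_nonneg hε.le (hm0 p)) (by positivity)).symm
      _ ≤ ENNReal.ofReal ((1 + 4 * ε) * (gdist G p q).toReal) := ENNReal.ofReal_le_ofReal hfinal
      _ = ENNReal.ofReal (1 + 4 * ε) * gdist G p q := by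
        rw [ENNReal.ofReal_mul (by positivity), ENNReal.ofReal_toReal hpq]

end Spanner

/-- Corollary 8: walk-to-path spanners without planarity. -/
theorem walk_to_path_spanner :
    ∃ C : ℝ, 0 < C ∧
      ∀ (V : Type u) [Fintype V] [DecidableEq V] (G : WGraph V) (ε : ℝ),
        0 < ε → ε < 1 →
        ∀ (a : V) (lW : List V), List.Chain (fun x y => s(x, y) ∈ G.edges) a lW →
        ∀ (p₁ p₂ : V) (lP : List V), IsShortestPath G p₁ p₂ lP →
        ∀ R : ℝ≥0∞, R = (⨅ v ∈ a :: lW, ⨅ u ∈ p₁ :: lP, gdist G v u) → R ≠ ⊤ →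
          ∃ F ⊆ G.edges, edgesOfWalk a lW ⊆ F ∧
            setWeight G F ≤ C * (ε⁻¹ ^ 3 * walkLen G.w a lW + ε⁻¹ ^ 2 * R.toReal) ∧
            ∀ p ∈ a :: lW, ∀ q ∈ p₁ :: lP,
              distIn G (F ∪ edgesOfWalk p₁ lP) p q ≤
                ENNReal.ofReal (1 + 4 * ε) * gdist G p q := by
  exact ⟨16, by norm_num, fun V _ _ G ε hε hε1 a lW hW p₁ p₂ lP hP R hR hRt =>
    main_aux G ε hε hε1 a lW hW p₁ p₂ lP hP R hR hRt⟩
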